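/- For any two disjoint finite sets T₁, T₂ of positive real numbers, there exist a probability measure P on ℝ × Bool (finitely supported) and two classifiers c₁, c₂ : ℝ → Bool such that R_{c₁}(t) < R_{c₂}(t) for every t ∈ T₁ and R_{c₁}(t) > R_{c₂}(t) for every t ∈ T₂, where R_c denotes the robustness curve of c with respect to P. -/

import Mathlib

open MeasureTheory
open scoped ENNReal

/-- The robustness curve of a classifier `c : ℝ → Bool` with respect to a measure `P`
on `ℝ × Bool`: `R_c(ε) = P {(x, y) | ∃ x', |x - x'| ≤ ε ∧ c x' ≠ y}`. -/
noncomputable def robCurve (P : Measure (ℝ × Bool)) (c : ℝ → Bool) (ε : ℝ) : ℝ≥0∞ :=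
  P {z : ℝ × Bool | ∃ x' : ℝ, |z.1 - x'| ≤ ε ∧ c x' ≠ z.2}

/-- A finite set of reals carries weights each of which exceeds the sum of all earlier ones. -/
theorem exists_superincreasing_weight (T : Finset ℝ) :
    ∃ w : ℝ → ℕ, ∀ t ∈ T, ∑ s ∈ T with s < t, w s < w t := by
  induction T using Finset.induction_on_max with
  | empty => exact ⟨fun _ => 0, by simp⟩
  | insert a T ha ih =>
    obtain ⟨w, hw⟩ := ih
    have hne : ∀ s ∈ T, s ≠ a := fun s hs => (ha s hs).ne
    refine ⟨Function.update w a (∑ s ∈ T, w s + 1), fun t ht => ?_⟩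
    have hsum : ∀ U ⊆ T,
        ∑ s ∈ U, Function.update w a (∑ s ∈ T, w s + 1) s = ∑ s ∈ U, w s := fun U hU =>
      Finset.sum_congr rfl fun s hs => Function.update_of_ne (hne s (hU hs)) _ _
    rcases Finset.mem_insert.1 ht with rfl | ht
    · rw [Finset.filter_insert, if_neg (lt_irrefl _), hsum _ (Finset.filter_subset _ _),
        Function.update_self, Nat.lt_succ_iff]
      exact Finset.sum_le_sum_of_subset (Finset.filter_subset _ _)
    · rw [Finset.filter_insert, if_neg (ha t ht).not_gt, hsum _ (Finset.filter_subset _ _),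
        Function.update_of_ne (hne t ht)]
      exact hw t ht

/-- The combination of point masses at `x t`, `t ∈ T`, with weights `w t`. -/
noncomputable def sumDirac {α : Type*} [MeasurableSpace α] (T : Finset ℝ) (w : ℝ → ℕ)
    (x : ℝ → α) : Measure α :=
  ∑ t ∈ T, (w t : ℝ≥0∞) • Measure.dirac (x t)

theorem sumDirac_apply {α : Type*} [MeasurableSpace α] [MeasurableSingletonClass α]
    (T : Finset ℝ) (w : ℝ → ℕ) (x : ℝ → α) (A : Set α) [DecidablePred (x · ∈ A)] :
    sumDirac T w x A = ((∑ t ∈ T with x t ∈ A, w t : ℕ) : ℝ≥0∞) := by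
  simp only [sumDirac, Measure.coe_finsetSum, Finset.sum_apply, Measure.smul_apply,
    Measure.dirac_apply, smul_eq_mul, Finset.sum_filter, Nat.cast_sum]
  refine Finset.sum_congr rfl fun t _ => ?_
  by_cases h : x t ∈ A <;> simp [h]

/-- With superincreasing weights, a set containing the atom of index `t` has larger mass than a
set containing only atoms of smaller index. -/
theorem sumDirac_lt_sumDirac {α : Type*} [MeasurableSpace α] [MeasurableSingletonClass α]
    {T : Finset ℝ} {w : ℝ → ℕ} (hw : ∀ t ∈ T, ∑ s ∈ T with s < t, w s < w t) (x : ℝ → α)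
    {A B : Set α} {t : ℝ} (ht : t ∈ T) (hA : ∀ s ∈ T, x s ∈ A → s < t) (hB : x t ∈ B) :
    sumDirac T w x A < sumDirac T w x B := by
  classical
  rw [sumDirac_apply, sumDirac_apply, Nat.cast_lt]
  calc ∑ s ∈ T with x s ∈ A, w s ≤ ∑ s ∈ T with s < t, w s :=
        Finset.sum_le_sum_of_subset fun s hs => by
          rw [Finset.mem_filter] at hs ⊢
          exact ⟨hs.1, hA s hs.1 hs.2⟩
    _ < w t := hw t ht
    _ ≤ ∑ s ∈ T with x s ∈ B, w s :=
        Finset.single_le_sum (f := w) (fun _ _ => Nat.zero_le _)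
          (Finset.mem_filter.2 ⟨ht, hB⟩)

/-- A classifier that is wrong about the label `true` only at `a` is not robust at `z` exactly
when `a` is within reach of `z`. -/
theorem exists_decide_ne_true_iff (a z ε : ℝ) :
    (∃ x' : ℝ, |z - x'| ≤ ε ∧ decide (x' ≠ a) ≠ true) ↔ |z - a| ≤ ε := by
  simp

/-- For any two disjoint finite sets `T₁, T₂` of positive reals, there exist a finitely
supported probability measure `P` on `ℝ × Bool` and classifiers `c₁, c₂ : ℝ → Bool` such
that the robustness curve of `c₁` is strictly below that of `c₂` on `T₁` and strictly
above it on `T₂`. -/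
theorem robustness_curves_arbitrary_intersections
    (T₁ T₂ : Finset ℝ) (hT₁ : ∀ t ∈ T₁, 0 < t) (hT₂ : ∀ t ∈ T₂, 0 < t)
    (hdisj : Disjoint T₁ T₂) :
    ∃ (P : Measure (ℝ × Bool)) (c₁ c₂ : ℝ → Bool),
      IsProbabilityMeasure P ∧
      (∃ s : Finset (ℝ × Bool), P ((↑s : Set (ℝ × Bool))ᶜ) = 0) ∧
      (∀ t ∈ T₁, robCurve P c₁ t < robCurve P c₂ t) ∧
      (∀ t ∈ T₂, robCurve P c₂ t < robCurve P c₁ t) := by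
  classical
  set T := T₁ ∪ T₂ with hT
  rcases T.eq_empty_or_nonempty with hemp | ⟨t₀, ht₀⟩
  · obtain ⟨rfl, rfl⟩ := Finset.union_eq_empty.1 hemp
    exact ⟨Measure.dirac (0, true), fun _ => true, fun _ => true, inferInstance,
      ⟨{(0, true)}, by simp⟩, by simp, by simp⟩
  obtain ⟨w, hw⟩ := exists_superincreasing_weight T
  obtain ⟨L, hL⟩ : ∃ L : ℝ, ∀ t ∈ T, t < L := by
    obtain ⟨M, hM⟩ := T.bddAbove
    exact ⟨M + 1, fun t ht => (hM ht).trans_lt (lt_add_one M)⟩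
  have hpos : ∀ t ∈ T, 0 < t := fun t ht =>
    (Finset.mem_union.1 ht).elim (hT₁ t) (hT₂ t)
  let x : ℝ → ℝ × Bool := fun t => (if t ∈ T₁ then L + t else -t, true)
  have hx₁ : ∀ t ∈ T₁, x t = (L + t, true) := fun t ht => by simp [x, ht]
  have hx₂ : ∀ t ∈ T₂, x t = (-t, true) := fun t ht => by
    simp [x, Finset.disjoint_right.1 hdisj ht]
  let μ := sumDirac T w x
  have hμ_top : μ Set.univ ≠ ∞ := by
    simp only [μ, sumDirac_apply]
    exact ENNReal.natCast_ne_top _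
  have hμ_zero : μ Set.univ ≠ 0 :=
    (zero_le.trans_lt (sumDirac_lt_sumDirac hw x (A := ∅) ht₀ (by simp)
      (Set.mem_univ _))).ne'
  have hscale : ∀ {A B : Set (ℝ × Bool)}, μ A < μ B →
      ((μ Set.univ)⁻¹ • μ) A < ((μ Set.univ)⁻¹ • μ) B := fun h => by
    simp only [Measure.smul_apply, smul_eq_mul]
    exact (ENNReal.mul_lt_mul_iff_right (ENNReal.inv_ne_zero.2 hμ_top)
      (ENNReal.inv_ne_top.2 hμ_zero)).2 h
  refine ⟨(μ Set.univ)⁻¹ • μ, fun z => decide (z ≠ 0), fun z => decide (z ≠ L), ⟨?_⟩,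
    ⟨T.image x, ?_⟩, fun t ht => hscale ?_, fun t ht => hscale ?_⟩
  · rw [Measure.smul_apply, smul_eq_mul, ENNReal.inv_mul_cancel hμ_zero hμ_top]
  · have : μ ((T.image x : Finset (ℝ × Bool)) : Set (ℝ × Bool))ᶜ = 0 := by
      simp only [μ, sumDirac_apply, Nat.cast_eq_zero]
      refine Finset.sum_eq_zero fun t ht => absurd ?_ (Finset.mem_filter.1 ht).2
      exact Finset.mem_coe.2 (Finset.mem_image_of_mem x (Finset.mem_filter.1 ht).1)
    rw [Measure.smul_apply, this, smul_zero]
  · have htT : t ∈ T := Finset.mem_union_left _ ht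
    refine sumDirac_lt_sumDirac hw x htT (fun s hs hsA => ?_) ?_
    · have hs0 := hpos s hs
      rcases Finset.mem_union.1 hs with h | h
      · rw [hx₁ s h, Set.mem_ofPred_eq, exists_decide_ne_true_iff] at hsA
        linarith [le_abs_self (L + s - 0), hL t htT]
      · rw [hx₂ s h, Set.mem_ofPred_eq, exists_decide_ne_true_iff] at hsA
        refine lt_of_le_of_ne (by linarith [neg_le_abs (-s - 0)]) ?_
        rintro rfl
        exact Finset.disjoint_left.1 hdisj ht h
    · rw [hx₁ t ht, Set.mem_ofPred_eq, exists_decide_ne_true_iff, add_sub_cancel_left,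
        abs_of_pos (hpos t htT)]
  · have htT : t ∈ T := Finset.mem_union_right _ ht
    refine sumDirac_lt_sumDirac hw x htT (fun s hs hsA => ?_) ?_
    · have hs0 := hpos s hs
      rcases Finset.mem_union.1 hs with h | h
      · rw [hx₁ s h, Set.mem_ofPred_eq, exists_decide_ne_true_iff] at hsA
        refine lt_of_le_of_ne (by linarith [le_abs_self (L + s - L)]) ?_
        rintro rfl
        exact Finset.disjoint_left.1 hdisj h ht
      · rw [hx₂ s h, Set.mem_ofPred_eq, exists_decide_ne_true_iff] at hsA
        linarith [neg_le_abs (-s - L), hL t htT]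
    · rw [hx₂ t ht, Set.mem_ofPred_eq, exists_decide_ne_true_iff, sub_zero, abs_neg,
        abs_of_pos (hpos t htT)]
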